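/- Let c ≠ ±1 be a squarefree integer with c ≡ 1 (mod 4) such that f(x) = x^5 + c·(x^2 + 2x + 1) ∈ ℤ[x] is irreducible, let θ be a root of f and K = ℚ(θ). Then {1, θ, θ^2, θ^3, θ^4} is an integral basis of K (i.e., ℤ_K = ℤ[θ]) if and only if 3125 − 108·c is squarefree. -/

import Mathlib

open Polynomial NumberField

/-- The discriminant of a monic integer polynomial `f`, defined as the discriminant of the
power basis of `ℤ[X]/(f)` (junk value `0` if `f` is not monic). -/
noncomputable def polyDisc (f : Polynomial ℤ) : ℤ :=
  if hf : f.Monic then Algebra.discr ℤ (AdjoinRoot.powerBasis' hf).basis else 0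

/-- The index `[ℤ_K : ℤ[θ]]` of the order generated by `θ` in the ring of integers. -/
noncomputable def polyIndex {K : Type*} [Field K] [NumberField K] (θ : 𝓞 K) : ℕ :=
  ((Algebra.adjoin ℤ {θ}).toSubring.toAddSubgroup).index

/-- The discriminant of a power basis of `K` generated by an algebraic integer `θ` is the square
of the index of `ℤ[θ]` times the discriminant of `K`. -/
theorem discr_powerBasis_eq_sq_index_mul_discr {K : Type*} [Field K] [NumberField K] (θ : 𝓞 K)
    (B : PowerBasis ℚ K) (hB : B.gen = θ) :
    Algebra.discr ℚ B.basis = (polyIndex θ : ℚ) ^ 2 * NumberField.discr K := by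
  let A := Algebra.adjoin.powerBasis' θ.isIntegral
  have hdim : A.dim = B.dim := by
    rw [Algebra.adjoin.powerBasis'_dim, ← B.natDegree_minpoly, hB,
      ← minpoly.algebraMap_eq RingOfIntegers.coe_injective θ,
      minpoly.isIntegrallyClosed_eq_field_fractions' ℚ (RingOfIntegers.isIntegral_coe θ)]
    exact ((minpoly.monic (RingOfIntegers.isIntegral_coe θ)).natDegree_map _).symm
  let bA : Module.Basis (Fin B.dim) ℤ (Algebra.adjoin ℤ {θ}) := A.basis.reindex (finCongr hdim)
  have hbA (i : Fin B.dim) : (bA i : 𝓞 K) = θ ^ (i : ℕ) := by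
    simp only [bA, A, Module.Basis.reindex_apply, PowerBasis.basis_eq_pow,
      Algebra.adjoin.powerBasis'_gen]
    rfl
  have hcard : Fintype.card (Module.Free.ChooseBasisIndex ℤ (𝓞 K)) = Fintype.card (Fin B.dim) := by
    rw [← Module.finrank_eq_card_chooseBasisIndex, RingOfIntegers.rank, Fintype.card_fin, B.finrank]
  let e := Fintype.equivOfCardEq hcard
  let w := (RingOfIntegers.basis K).reindex e
  have hidx : polyIndex θ = (w.det (bA ·)).natAbs :=
    AddSubgroup.index_eq_natAbs_det w (Algebra.adjoin ℤ {θ}).toSubring.toAddSubgroup bA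
  let P := w.toMatrix (fun i => (bA i : 𝓞 K))
  have hP : B.basis = Matrix.vecMul (integralBasis K ∘ e.symm)
      ((P.map (algebraMap ℤ ℚ)).map (algebraMap ℚ K)) := by
    ext i
    have h := w.sum_toMatrix_smul_self (fun i => (bA i : 𝓞 K)) i
    apply_fun algebraMap (𝓞 K) K at h
    rw [hbA] at h
    simp only [B.basis_eq_pow, hB]
    rw [← map_pow, ← h, map_sum]
    simp only [Matrix.vecMul, dotProduct, Function.comp, integralBasis_apply, Matrix.map_apply, P, w,
      Module.Basis.reindex_apply]
    refine Finset.sum_congr rfl fun j _ => ?_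
    simp [mul_comm]
  rw [hP, Algebra.discr_of_matrix_vecMul, Algebra.discr_reindex, ← NumberField.coe_discr]
  congr 1
  rw [hidx, Module.Basis.det_apply, ← RingHom.mapMatrix_apply, ← RingHom.map_det, Nat.cast_natAbs]
  simp [P]

theorem PowerBasis.norm_algebraMap_sub_gen {F L : Type*} [Field F] [Field L] [Algebra F L]
    (B : PowerBasis F L) (t : F) :
    Algebra.norm F (algebraMap F L t - B.gen) = (minpoly F B.gen).eval t := by
  rw [← charpoly_leftMulMatrix, Matrix.eval_charpoly, Algebra.norm_eq_matrix_det B.basis, map_sub,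
    AlgHom.commutes]
  rfl

/-- If a prime divides the finite index of `ℤ[θ]`, some algebraic integer outside `ℤ[θ]` has its
`p`-th multiple in `ℤ[θ]`. -/
theorem exists_prime_smul_mem_adjoin {K : Type*} [Field K] [NumberField K] (θ : 𝓞 K)
    (h0 : polyIndex θ ≠ 0) {p : ℕ} (hp : p.Prime) (hdvd : p ∣ polyIndex θ) :
    ∃ z : 𝓞 K, z ∉ Algebra.adjoin ℤ {θ} ∧ (p : ℤ) • z ∈ Algebra.adjoin ℤ {θ} := by
  let N := (Algebra.adjoin ℤ {θ}).toSubring.toAddSubgroup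
  have : Fact p.Prime := ⟨hp⟩
  have : N.FiniteIndex := ⟨h0⟩
  obtain ⟨x, hx⟩ := exists_prime_addOrderOf_dvd_card' (G := 𝓞 K ⧸ N) p hdvd
  obtain ⟨z, rfl⟩ := QuotientAddGroup.mk_surjective x
  refine ⟨z, fun hz => ?_, ?_⟩
  · have : (z : 𝓞 K ⧸ N) = 0 := (QuotientAddGroup.eq_zero_iff z).2 hz
    rw [this, addOrderOf_zero] at hx
    exact hp.one_lt.ne hx
  · have h := addOrderOf_nsmul_eq_zero (z : 𝓞 K ⧸ N)
    rw [hx, ← QuotientAddGroup.mk_nsmul, QuotientAddGroup.eq_zero_iff] at h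
    rw [natCast_zsmul]
    exact h

theorem coe_mem_adjoin_coe_iff {K : Type*} [Field K] [NumberField K] (θ z : 𝓞 K) :
    (z : K) ∈ Algebra.adjoin ℤ {(θ : K)} ↔ z ∈ Algebra.adjoin ℤ {θ} := by
  have h := AlgHom.map_adjoin_singleton (IsScalarTower.toAlgHom ℤ (𝓞 K) K) θ
  simp only [IsScalarTower.coe_toAlgHom'] at h
  rw [← h]
  exact (RingOfIntegers.coe_injective.mem_set_image : _ ↔ z ∈ (Algebra.adjoin ℤ {θ} : Set (𝓞 K)))

theorem minpoly_coe_eq {K : Type*} [Field K] [NumberField K] {f : ℤ[X]} (hf : f.Monic)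
    (hirr : Irreducible f) (θ : 𝓞 K) (hroot : aeval (θ : K) f = 0) : minpoly ℤ (θ : K) = f := by
  have hint := RingOfIntegers.isIntegral_coe θ
  have hdvd := minpoly.isIntegrallyClosed_dvd hint hroot
  exact eq_of_monic_of_associated (minpoly.monic hint) hf
    ((minpoly.irreducible hint).associated_of_dvd hirr hdvd)

/-- The quintic `X ^ 5 + c (X + 1) ^ 2`. -/
noncomputable def quintic (c : ℤ) : ℤ[X] := X ^ 5 + C c * X ^ 2 + C (2 * c) * X + C c

theorem quintic_monic (c : ℤ) : (quintic c).Monic := by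
  unfold quintic
  monicity!

theorem quintic_natDegree (c : ℤ) : (quintic c).natDegree = 5 := by
  unfold quintic
  compute_degree!

theorem aeval_quintic {R : Type*} [CommRing R] (c : ℤ) (x : R) :
    aeval x (quintic c) = x ^ 5 + c * x ^ 2 + 2 * c * x + c := by
  simp only [quintic, map_add, map_mul, map_pow, aeval_X, aeval_C]
  simp

theorem quintic_isEisensteinAt {c p : ℤ} (hc : Squarefree c) (hp : Prime p) (hpc : p ∣ c) :
    (quintic c).IsEisensteinAt (Submodule.span ℤ {p}) where
  leading := by
    rw [(quintic_monic c).leadingCoeff, Ideal.submodule_span_eq, Ideal.mem_span_singleton]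
    exact hp.not_dvd_one
  mem {n} hn := by
    rw [quintic_natDegree] at hn
    rw [Ideal.submodule_span_eq, Ideal.mem_span_singleton]
    have h2 : p ∣ 2 * c := hpc.mul_left 2
    interval_cases n <;> simp [quintic, coeff_X, coeff_C, coeff_X_pow, hpc, h2, -eq_intCast]
  notMem h := by
    rw [Ideal.submodule_span_eq, Ideal.span_singleton_pow, Ideal.mem_span_singleton] at h
    have h0 : (quintic c).coeff 0 = c := by simp [quintic, -eq_intCast]
    rw [h0, sq] at h
    exact hp.not_isUnit (hc p h)

section

variable {K : Type*} [Field K] [NumberField K]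

theorem sq_index_mul_discr_quintic {c : ℤ} (hc0 : c ≠ 0) (hirr : Irreducible (quintic c)) (θ : 𝓞 K)
    (hroot : aeval (θ : K) (quintic c) = 0) (B : PowerBasis ℚ K) (hB : B.gen = θ) :
    (polyIndex θ : ℤ) ^ 2 * NumberField.discr K = c ^ 4 * (3125 - 108 * c) := by
  have hmin : minpoly ℚ B.gen = (quintic c).map (algebraMap ℤ ℚ) := by
    rw [hB, minpoly.isIntegrallyClosed_eq_field_fractions' ℚ (RingOfIntegers.isIntegral_coe θ),
      minpoly_coe_eq (quintic_monic c) hirr θ hroot]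
  have hrank : Module.finrank ℚ K = 5 := by
    rw [B.finrank, ← B.natDegree_minpoly, hmin, (quintic_monic c).natDegree_map, quintic_natDegree]
  have hnorm (t : ℚ) : Algebra.norm ℚ (algebraMap ℚ K t - B.gen) =
      t ^ 5 + c * t ^ 2 + 2 * c * t + c := by
    rw [PowerBasis.norm_algebraMap_sub_gen, hmin]
    simp [quintic]
  have hder : aeval B.gen (derivative (minpoly ℚ B.gen)) * (algebraMap ℚ K 0 - B.gen) =
      algebraMap ℚ K (3 * c) * (algebraMap ℚ K (-1) - B.gen) * (algebraMap ℚ K (-5 / 3) - B.gen) := by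
    have h0 : B.gen ^ 5 + c * B.gen ^ 2 + 2 * c * B.gen + c = 0 := by
      rwa [hB, ← aeval_quintic]
    have hder' : derivative (quintic c) = C 5 * X ^ 4 + C (2 * c) * X + C (2 * c) := by
      simp [quintic, -eq_intCast]
      ring
    rw [hmin, derivative_map, aeval_map_algebraMap, hder']
    simp only [map_add, map_mul, map_pow, map_div₀, aeval_X, aeval_C]
    simp
    linear_combination -5 * h0
  apply_fun Algebra.norm ℚ at hder
  rw [map_mul, map_mul, map_mul, hnorm, hnorm, hnorm, Algebra.norm_algebraMap, hrank] at hder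
  have hc : (c : ℚ) ≠ 0 := by exact_mod_cast hc0
  have hd := discr_powerBasis_eq_sq_index_mul_discr θ B hB
  rw [Algebra.discr_powerBasis_eq_norm, hrank] at hd
  have hfin : (polyIndex θ : ℚ) ^ 2 * NumberField.discr K = c ^ 4 * (3125 - 108 * c) := by
    rw [← hd]
    apply mul_right_cancel₀ hc
    rw [show 5 * (5 - 1) / 2 = 10 from rfl]
    linear_combination hder
  exact_mod_cast hfin

theorem adjoin_eq_top_of_squarefree {c : ℤ} (hc : Squarefree c) (hD : Squarefree (3125 - 108 * c))
    (hirr : Irreducible (quintic c)) (θ : 𝓞 K)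
    (hroot : aeval (θ : K) (quintic c) = 0) (hgen : Algebra.adjoin ℚ {(θ : K)} = ⊤) :
    Algebra.adjoin ℤ {θ} = ⊤ := by
  have hint := RingOfIntegers.isIntegral_coe θ
  let B : PowerBasis ℚ K := PowerBasis.ofAdjoinEqTop hint.tower_top hgen
  have hB : B.gen = θ := PowerBasis.ofAdjoinEqTop_gen _ _
  have hdisc := sq_index_mul_discr_quintic hc.ne_zero hirr θ hroot B hB
  have h0 : polyIndex θ ≠ 0 := by
    intro h
    rw [h] at hdisc
    have := mul_ne_zero (pow_ne_zero 4 hc.ne_zero) hD.ne_zero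
    exact this (by simpa using hdisc.symm)
  have hcop : IsCoprime (polyIndex θ : ℤ) c := by
    refine Int.isCoprime_iff_gcd_eq_one.2 (Nat.coprime_of_dvd fun p hp hpi hpc => ?_)
    obtain ⟨z, hz, hpz⟩ := exists_prime_smul_mem_adjoin θ h0 hp hpi
    refine hz ((coe_mem_adjoin_coe_iff θ z).1 ?_)
    have hei : (minpoly ℤ B.gen).IsEisensteinAt (Submodule.span ℤ {(p : ℤ)}) := by
      rw [hB, minpoly_coe_eq (quintic_monic c) hirr θ hroot]
      exact quintic_isEisensteinAt hc (Nat.prime_iff_prime_int.1 hp) (Int.natCast_dvd.2 hpc)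
    rw [← hB]
    refine mem_adjoin_of_smul_prime_smul_of_minpoly_isEisensteinAt (Nat.prime_iff_prime_int.1 hp)
      (hB ▸ hint) (RingOfIntegers.isIntegral_coe z) ?_ hei
    rw [hB]
    simpa using (coe_mem_adjoin_coe_iff θ _).2 hpz
  have hdvd : (polyIndex θ : ℤ) ^ 2 ∣ 3125 - 108 * c :=
    (hcop.pow (m := 2) (n := 4)).dvd_of_dvd_mul_left ⟨_, hdisc.symm⟩
  rw [sq] at hdvd
  have h1 : polyIndex θ = 1 := by simpa [Int.isUnit_iff_natAbs_eq] using hD _ hdvd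
  have htop := AddSubgroup.index_eq_one.1 h1
  refine eq_top_iff.2 fun z _ => ?_
  have hz : z ∈ (Algebra.adjoin ℤ {θ}).toSubring.toAddSubgroup := htop ▸ AddSubgroup.mem_top z
  exact hz

theorem squarefree_of_adjoin_eq_top {c : ℤ} (hirr : Irreducible (quintic c)) (θ : 𝓞 K)
    (hroot : aeval (θ : K) (quintic c) = 0) (htop : Algebra.adjoin ℤ {θ} = ⊤) :
    Squarefree (3125 - 108 * c) := by
  intro d hd
  have hd0 : d ≠ 0 := by
    rintro rfl
    rw [zero_mul, zero_dvd_iff] at hd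
    omega
  have hcop : IsCoprime (3 : ℤ) (d * d) := by
    obtain ⟨k, hk⟩ := hd
    have h1 : IsCoprime (3 : ℤ) (d * d * k) := ⟨72 * c - 2083, 2, by rw [← hk]; ring⟩
    exact h1.of_mul_right_left
  obtain ⟨u, v, huv⟩ := hcop
  -- a representative of `-5 / 3` modulo `d ^ 2`
  obtain ⟨a, ha⟩ : ∃ a : ℤ, a = -5 * u := ⟨_, rfl⟩
  have h3a : d * d ∣ 3 * a + 5 := ⟨5 * v, by rw [ha]; linear_combination -5 * huv⟩
  have hcop : IsCoprime (d * d) (3 : ℤ) := ⟨v, u, by linear_combination huv⟩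
  obtain ⟨r, hr⟩ : d * d ∣ a ^ 5 + c * a ^ 2 + 2 * c * a + c := by
    apply (hcop.pow_right (n := 5)).dvd_of_dvd_mul_left
    obtain ⟨k, hk⟩ := hd
    obtain ⟨t, ht⟩ : ∃ t, t = 3 * a + 5 := ⟨_, rfl⟩
    rw [← ht] at h3a
    have key : 3 ^ 5 * (a ^ 5 + c * a ^ 2 + 2 * c * a + c) = -(3125 - 108 * c) +
        t * (t ^ 4 - 25 * t ^ 3 + 250 * t ^ 2 - 1250 * t + 3125 + 27 * c * (t - 4)) := by
      rw [ht]
      ring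
    rw [key, hk]
    exact dvd_add (dvd_neg.2 (dvd_mul_right _ _)) (h3a.mul_right _)
  obtain ⟨s, hs⟩ : d ∣ 5 * a ^ 4 + 2 * c * a + 2 * c := by
    apply (Dvd.intro d rfl).trans
    apply (hcop.pow_right (n := 4)).dvd_of_dvd_mul_left
    obtain ⟨k, hk⟩ := hd
    obtain ⟨t, ht⟩ : ∃ t, t = 3 * a + 5 := ⟨_, rfl⟩
    rw [← ht] at h3a
    have key : 3 ^ 4 * (5 * a ^ 4 + 2 * c * a + 2 * c) = (3125 - 108 * c) +
        t * (5 * (t ^ 3 - 20 * t ^ 2 + 150 * t - 500) + 54 * c) := by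
      rw [ht]
      ring
    rw [key, hk]
    exact dvd_add (dvd_mul_right _ _) (h3a.mul_right _)
  have hθ : (θ : K) ^ 5 + c * (θ : K) ^ 2 + 2 * c * (θ : K) + c = 0 := by
    rwa [← aeval_quintic]
  have hr' : (a : K) ^ 5 + c * (a : K) ^ 2 + 2 * c * (a : K) + c = d * d * r := by exact_mod_cast hr
  have hs' : 5 * (a : K) ^ 4 + 2 * c * (a : K) + 2 * c = d * s := by exact_mod_cast hs
  have hdK : (d : K) ≠ 0 := by exact_mod_cast hd0
  let g : 𝓞 K := θ ^ 3 + 2 * a * θ ^ 2 + 3 * a ^ 2 * θ + (4 * a ^ 3 + c)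
  let β : K := ((θ : K) - a) * g / d
  have hβ : IsIntegral (𝓞 K) β := by
    refine ⟨X ^ 2 + C (s : 𝓞 K) * X + C (r * g), by monicity!, ?_⟩
    simp only [eval₂_add, eval₂_mul, eval₂_pow, eval₂_X, eval₂_C]
    simp only [β, g, map_add, map_mul, map_pow, map_intCast, map_ofNat]
    field_simp
    linear_combination ((θ : K) ^ 3 + 2 * a * θ ^ 2 + 3 * a ^ 2 * θ + (4 * a ^ 3 + c)) *
      (hθ - hr' - ((θ : K) - a) * hs')
  obtain ⟨b, hb⟩ := (IsIntegrallyClosed.isIntegral_iff (R := 𝓞 K)).1 hβ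
  have hbm : b ∈ Algebra.adjoin ℤ {θ} := htop ▸ Algebra.mem_top
  obtain ⟨h, hh⟩ := (Algebra.adjoin_singleton_eq_range_aeval ℤ θ ▸ hbm : b ∈ (aeval θ).range)
  let q : ℤ[X] := X ^ 4 + C a * X ^ 3 + C (a ^ 2) * X ^ 2 + C (a ^ 3 + c) * X - C (4 * a ^ 4 + c * a)
  have hqθ : aeval (θ : K) q = d * b := by
    simp only [q, map_add, map_sub, map_mul, map_pow, aeval_X, aeval_C]
    rw [show (b : K) = β from hb]
    simp only [β, g, map_add, map_mul, map_pow, map_intCast, map_ofNat, eq_intCast]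
    field_simp
    ring
  have hhθ : aeval (θ : K) (h %ₘ quintic c) = b := by
    rw [aeval_modByMonic_eq_self_of_root hroot, ← hh]
    exact aeval_algebraMap_apply K θ h
  have hroot' : aeval (θ : K) (C d * (h %ₘ quintic c) - q) = 0 := by
    rw [map_sub, map_mul, hqθ, hhθ, aeval_C]
    simp
  have hdvd : quintic c ∣ C d * (h %ₘ quintic c) - q := by
    have := minpoly.isIntegrallyClosed_dvd (RingOfIntegers.isIntegral_coe θ) hroot'
    rwa [minpoly_coe_eq (quintic_monic c) hirr θ hroot] at this
  have hdeg : (C d * (h %ₘ quintic c) - q).natDegree < (quintic c).natDegree := by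
    have h1 := natDegree_modByMonic_lt h (quintic_monic c)
      (fun h => by simpa [h] using quintic_natDegree c)
    rw [quintic_natDegree] at h1 ⊢
    have h2 : q.natDegree ≤ 4 := by
      simp only [q]
      compute_degree
    exact (natDegree_sub_le _ _).trans_lt
      (max_lt ((natDegree_C_mul_le _ _).trans_lt h1) (h2.trans_lt (by norm_num)))
  have hzero := eq_zero_of_dvd_of_natDegree_lt hdvd hdeg
  have hcoeff := congrArg (coeff · 4) (sub_eq_zero.1 hzero)
  have hq4 : q.coeff 4 = 1 := by
    simp [q, coeff_X_pow, -eq_intCast, -map_mul, -map_add, -map_pow]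
  simp only [coeff_C_mul, hq4] at hcoeff
  exact IsUnit.of_mul_eq_one _ hcoeff

end

theorem stmt_18 (c : ℤ) (hc1 : c ≠ 1) (hc1' : c ≠ -1) (hcsf : Squarefree c)
    (hc4 : c ≡ 1 [ZMOD 4])
    (f : Polynomial ℤ) (hf : f = X ^ 5 + C c * X ^ 2 + C (2 * c) * X + C c)
    (hirr : Irreducible f)
    (K : Type*) [Field K] [NumberField K] (θ : 𝓞 K)
    (hroot : Polynomial.aeval (θ : K) f = 0)
    (hgen : Algebra.adjoin ℚ {(θ : K)} = ⊤) :
    Algebra.adjoin ℤ {θ} = ⊤ ↔ Squarefree (3125 - 108 * c) := by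
  subst hf
  exact ⟨squarefree_of_adjoin_eq_top hirr θ hroot,
    fun hD => adjoin_eq_top_of_squarefree hcsf hD hirr θ hroot hgen⟩
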